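/- Let k be a field and let T = k[[t]][x] be the polynomial ring in x over the power series ring k[[t]]. Then the cosupport of T is not a Zariski-closed subset of Spec(T); that is, there is no ideal J of T such that the set of primes p with Ext^i_T(T_p, Λ^p T) ≠ 0 for some i is equal to the set of primes containing J. -/

import Mathlib

open CategoryTheory Opposite

universe u

/-- The cosupport of a commutative ring `R`, as a subset of `Spec R`:
the primes `p` such that `Ext^i_R(R_p, Λ^p R) ≠ 0` for some `i`,
where `R_p` is the localization at `p` and `Λ^p R` the `p`-adic completion. -/
noncomputable def ringCosupport (R : Type u) [CommRing R] : Set (PrimeSpectrum R) :=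
  { p | ∃ i : ℕ, Nontrivial (((Ext R (ModuleCat.{u} R) i).obj
      (op (ModuleCat.of R (Localization.AtPrime p.asIdeal)))).obj
      (ModuleCat.of R (AdicCompletion p.asIdeal R))) }

section Telescope

variable {R : Type*} [CommRing R]

/-- The endomorphism `s ↦ (sₙ - t sₙ₊₁)ₙ` of `M^ℕ`. Its kernel and cokernel are
`Hom(R[1/t], M)` and `Ext¹(R[1/t], M)`. -/
def telescopeMap (t : R) (M : Type*) [AddCommGroup M] [Module R M] :
    (ℕ → M) →ₗ[R] (ℕ → M) where
  toFun s n := s n - t • s (n + 1)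
  map_add' s s' := by
    ext n
    simp only [Pi.add_apply, smul_add]
    abel
  map_smul' r s := by
    ext n
    simp only [Pi.smul_apply, smul_sub, RingHom.id_apply, smul_comm t r]

variable {t : R} {M : Type*} [AddCommGroup M] [Module R M]

@[simp]
lemma telescopeMap_apply (s : ℕ → M) (n : ℕ) :
    telescopeMap t M s n = s n - t • s (n + 1) := rfl

lemma telescopeMap_comp {N : Type*} [AddCommGroup N] [Module R N] (f : M →ₗ[R] N) (s : ℕ → M) :
    telescopeMap t N (f ∘ s) = f ∘ telescopeMap t M s := by
  ext n
  simp

end Telescope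

/-- A cocycle with values in a module that is derived complete along `t` bounds as soon as it
vanishes up to iterated divisibility by `t`. -/
lemma exists_comp_eq_of_telescopeMap_bijective {R : Type*} [CommRing R] {t : R}
    {A B M : Type*} [AddCommGroup A] [Module R A] [AddCommGroup B] [Module R B]
    [AddCommGroup M] [Module R M] (hM : Function.Bijective (telescopeMap t M))
    (d : A →ₗ[R] B) (u : ℕ → A →ₗ[R] M) (w : ℕ → B →ₗ[R] M)
    (h : ∀ n, u n - t • u (n + 1) = w n ∘ₗ d) :
    ∃ v : B →ₗ[R] M, u 0 = v ∘ₗ d := by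
  let e := LinearEquiv.ofBijective _ hM
  let W : B →ₗ[R] (ℕ → M) := e.symm.toLinearMap ∘ₗ LinearMap.pi w
  refine ⟨LinearMap.proj 0 ∘ₗ W, ?_⟩
  ext a
  suffices (fun n ↦ u n a) = W (d a) from congrFun this 0
  apply e.injective
  have hW : e (W (d a)) = LinearMap.pi w (d a) := e.apply_symm_apply _
  rw [hW]
  ext n
  exact LinearMap.congr_fun (h n) a

section Ext

variable {R : Type u} [CommRing R]

lemma subsingleton_Ext_iff {N M : ModuleCat.{u} R} (P : ProjectiveResolution N) (i : ℕ) :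
    Subsingleton (((Ext R (ModuleCat.{u} R) i).obj (op N)).obj M) ↔
      ∀ z : P.complex.X i ⟶ M, P.complex.d (i + 1) i ≫ z = 0 →
        ∃ w : P.complex.X ((ComplexShape.down ℕ).next i) ⟶ M,
          P.complex.d i ((ComplexShape.down ℕ).next i) ≫ w = z := by
  rw [← ModuleCat.isZero_iff_subsingleton, (P.isoExt (R := R) i M).isZero_iff,
    ← HomologicalComplex.exactAt_iff_isZero_homology,
    HomologicalComplex.exactAt_iff' _ ((ComplexShape.up ℕ).prev i) i (i + 1) rfl (by simp),
    ShortComplex.moduleCat_exact_iff]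
  rfl

lemma subsingleton_Ext_of_telescopeMap_bijective {t : R} {N M : ModuleCat.{u} R}
    (hN : Function.Bijective fun x : N ↦ t • x) (hM : Function.Bijective (telescopeMap t M))
    (i : ℕ) : Subsingleton (((Ext R (ModuleCat.{u} R) i).obj (op N)).obj M) := by
  let P := projectiveResolution N
  rw [subsingleton_Ext_iff P]
  intro z hz
  have : IsIso (t • 𝟙 N) := (ConcreteCategory.isIso_iff_bijective _).mpr hN
  obtain ⟨g, hg⟩ : ∃ g : N ⟶ N, t • g = 𝟙 N :=
    ⟨inv (t • 𝟙 N), by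
      rw [← cancel_epi (t • 𝟙 N), Linear.comp_smul, IsIso.hom_inv_id, Category.comp_id]⟩
  let σ := ProjectiveResolution.lift g P P
  have hσ : (t • σ) ≫ P.π = P.π ≫ (ChainComplex.single₀ _).map (𝟙 N) := by
    ext : 1
    change (t • σ.f 0) ≫ P.π.f 0 = P.π.f 0 ≫ 𝟙 N
    rw [Linear.smul_comp, ProjectiveResolution.lift_commutes_zero]
    exact (Linear.comp_smul _ _ _ (P.π.f 0) t g).symm.trans
      (congrArg (P.π.f 0 ≫ ·) hg)
  let H : Homotopy (𝟙 P.complex) (t • σ) :=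
    ProjectiveResolution.liftHomotopy (𝟙 N) _ _ (by simp) hσ
  let y : ℕ → (P.complex.X i ⟶ M) := fun n ↦ Nat.rec z (fun _ f ↦ σ.f i ≫ f) n
  have hy : ∀ n, P.complex.d (i + 1) i ≫ y n = 0 := by
    intro n
    induction n with
    | zero => exact hz
    | succ n ih =>
      change P.complex.d (i + 1) i ≫ σ.f i ≫ y n = 0
      rw [← HomologicalComplex.Hom.comm_assoc, ih, Limits.comp_zero]
  obtain ⟨v, hv⟩ := exists_comp_eq_of_telescopeMap_bijective hM
    (P.complex.d i ((ComplexShape.down ℕ).next i)).hom (fun n ↦ (y n).hom)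
    (fun n ↦ (H.hom ((ComplexShape.down ℕ).next i) i ≫ y n).hom) (by
      intro n
      have h₁ : 𝟙 _ = dNext i H.hom + prevD i H.hom + t • σ.f i := H.comm i
      have h₂ : prevD i H.hom ≫ y n = 0 := by
        rw [prevD_eq H.hom (show (ComplexShape.down ℕ).Rel (i + 1) i by simp), Category.assoc,
          hy, Limits.comp_zero]
      have h₃ : y n - t • y (n + 1) =
          P.complex.d i ((ComplexShape.down ℕ).next i) ≫
            H.hom ((ComplexShape.down ℕ).next i) i ≫ y n := by
        rw [sub_eq_iff_eq_add]
        calc y n = 𝟙 _ ≫ y n := (Category.id_comp _).symm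
          _ = _ := by
            rw [h₁, Preadditive.add_comp, Preadditive.add_comp, h₂, add_zero, Linear.smul_comp]
            exact congrArg (· + _) (Category.assoc _ _ _)
      exact congrArg ModuleCat.Hom.hom h₃)
  exact ⟨ModuleCat.ofHom v, ModuleCat.hom_ext hv.symm⟩

lemma nontrivial_Ext_zero {N M : ModuleCat.{u} R} (f : N ⟶ M) (hf : f ≠ 0) :
    Nontrivial (((Ext R (ModuleCat.{u} R) 0).obj (op N)).obj M) := by
  let P := projectiveResolution N
  rw [← not_subsingleton_iff_nontrivial, subsingleton_Ext_iff P]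
  intro h
  let π : P.complex.X 0 ⟶ N := P.π.f 0
  have : Epi π := inferInstanceAs (Epi (P.π.f 0))
  have hπ : P.complex.d (0 + 1) 0 ≫ π = 0 := P.complex_d_comp_π_f_zero
  obtain ⟨w, hw⟩ := h (π ≫ f) (by rw [← Category.assoc, hπ, Limits.zero_comp])
  rw [P.complex.shape _ _ (by simp), Limits.zero_comp] at hw
  refine hf ?_
  rw [← cancel_epi π, ← hw, Limits.comp_zero]

end Ext

section AdicCompletion

variable {R : Type u} [CommRing R]

lemma AdicCompletion.telescopeMap_bijective {t : R} {I : Ideal R} {M : Type*} [AddCommGroup M]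
    [Module R M]
    (h : ∀ n, Function.Bijective (telescopeMap t (M ⧸ (I ^ n • ⊤ : Submodule R M)))) :
    Function.Bijective (telescopeMap t (AdicCompletion I M)) := by
  constructor
  · intro s s' hs
    ext i n
    have := (h n).1 (a₁ := AdicCompletion.eval I M n ∘ s) (a₂ := AdicCompletion.eval I M n ∘ s')
      (by rw [telescopeMap_comp, telescopeMap_comp, hs])
    exact congrFun this i
  · intro m
    choose s hs using fun n ↦ (h n).2 (AdicCompletion.eval I M n ∘ m)
    have compat : ∀ {a b : ℕ} (hab : a ≤ b), AdicCompletion.transitionMap I M hab ∘ s b = s a := by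
      intro a b hab
      apply (h a).1
      rw [telescopeMap_comp, hs, hs]
      ext i
      exact (m i).2 hab
    refine ⟨fun i ↦ ⟨fun n ↦ s n i, fun hab ↦ congrFun (compat hab) i⟩, ?_⟩
    ext i n
    exact congrFun (hs n) i

lemma AdicCompletion.smul_bijective {r : R} {I : Ideal R} {M : Type*} [AddCommGroup M] [Module R M]
    (h : ∀ n, Function.Bijective fun x : M ⧸ (I ^ n • ⊤ : Submodule R M) ↦ r • x) :
    Function.Bijective fun x : AdicCompletion I M ↦ r • x := by
  constructor
  · intro x y hxy
    ext n
    exact (h n).1 (congrArg (AdicCompletion.eval I M n) hxy)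
  · intro x
    choose y hy using fun n ↦ (h n).2 (x.val n)
    refine ⟨⟨y, fun {a b} hab ↦ (h a).1 ?_⟩, ?_⟩
    · change r • AdicCompletion.transitionMap I M hab (y b) = r • y a
      rw [← map_smul]
      refine (congrArg _ (hy b)).trans ((x.2 hab).trans (hy a).symm)
    · ext n
      exact hy n

lemma smul_quotient_pow_bijective (p : Ideal R) [p.IsMaximal] {r : R} (hr : r ∉ p) (M : Type*)
    [AddCommGroup M] [Module R M] (n : ℕ) :
    Function.Bijective fun x : M ⧸ (p ^ n • ⊤ : Submodule R M) ↦ r • x := by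
  obtain ⟨a, c, hc, hac⟩ : ∃ a, ∃ c ∈ p ^ n, a * r + c = 1 := by
    have : Ideal.span {r} ⊔ p ^ n = ⊤ := by
      obtain ⟨b, c, hc, h⟩ := ‹p.IsMaximal›.exists_inv hr
      refine Ideal.sup_pow_eq_top ((Ideal.eq_top_iff_one _).mpr ?_)
      rw [← h]
      exact Submodule.add_mem_sup (Ideal.mul_mem_left _ b (Ideal.mem_span_singleton_self r)) hc
    obtain ⟨b, hb, c, hc, h⟩ := Submodule.mem_sup.mp (this ▸ Submodule.mem_top : (1 : R) ∈ _)
    obtain ⟨a, rfl⟩ := Ideal.mem_span_singleton'.mp hb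
    exact ⟨a, c, hc, h⟩
  have key : ∀ x : M ⧸ (p ^ n • ⊤ : Submodule R M), a • r • x = x := by
    intro x
    obtain ⟨x, rfl⟩ := Submodule.Quotient.mk_surjective _ x
    rw [← Submodule.Quotient.mk_smul, ← Submodule.Quotient.mk_smul, Submodule.Quotient.eq,
      smul_smul, show (a * r) • x - x = -(c • x) by rw [eq_sub_of_add_eq hac]; module]
    exact neg_mem (Submodule.smul_mem_smul hc Submodule.mem_top)
  exact ⟨Function.LeftInverse.injective (g := fun x ↦ a • x) key,
    Function.RightInverse.surjective (g := fun x ↦ a • x) fun x ↦ (smul_comm r a x).trans (key x)⟩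

end AdicCompletion

lemma mem_ringCosupport_of_isMaximal {R : Type u} [CommRing R] (p : PrimeSpectrum R)
    (hp : p.asIdeal.IsMaximal) : p ∈ ringCosupport R := by
  refine ⟨0, ?_⟩
  let f := IsLocalizedModule.lift p.asIdeal.primeCompl
    (Algebra.linearMap R (Localization.AtPrime p.asIdeal)) (AdicCompletion.of p.asIdeal R)
    (fun s ↦ (Module.End.isUnit_iff _).mpr
      (AdicCompletion.smul_bijective (smul_quotient_pow_bijective p.asIdeal s.2 R)))
  refine nontrivial_Ext_zero (ModuleCat.ofHom f) fun hf ↦ ?_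
  have h₁ : f 1 = AdicCompletion.of p.asIdeal R 1 := by
    rw [← map_one (algebraMap R _)]
    exact IsLocalizedModule.lift_apply _ _ _ _ 1
  have h₂ : f = 0 := congrArg ModuleCat.Hom.hom hf
  have h₃ := congrArg (AdicCompletion.eval p.asIdeal R 1) (h₁.symm.trans (congrArg (· 1) h₂))
  rw [AdicCompletion.eval_of] at h₃
  refine (Ideal.ne_top_iff_one _).mp hp.ne_top ?_
  simpa using (Submodule.Quotient.mk_eq_zero _).mp h₃

/-- Over a ring which is derived complete along `t`, so is every truncated polynomial ring. -/
lemma telescopeMap_polynomial_bijective {A : Type u} [CommRing A] {t : A}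
    (h : Function.Bijective (telescopeMap t A)) {J : Ideal (Polynomial A)} {n : ℕ}
    (hJ : J = Ideal.span {Polynomial.X ^ n}) :
    Function.Bijective (telescopeMap (Polynomial.C t) (Polynomial A ⧸ J)) := by
  subst hJ
  have mk_eq : ∀ f g : Polynomial A,
      Ideal.Quotient.mk (Ideal.span {Polynomial.X ^ n}) f =
        Ideal.Quotient.mk (Ideal.span {Polynomial.X ^ n}) g ↔
      ∀ i < n, f.coeff i = g.coeff i := by
    intro f g
    rw [Ideal.Quotient.eq, Ideal.mem_span_singleton, Polynomial.X_pow_dvd_iff]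
    simp only [Polynomial.coeff_sub, sub_eq_zero]
  constructor
  · rw [← LinearMap.ker_eq_bot, LinearMap.ker_eq_bot']
    intro s hs
    choose g hg using fun i ↦ Ideal.Quotient.mk_surjective (s i)
    have hgC : ∀ i, ∀ j < n, (g i).coeff j = t * (g (i + 1)).coeff j := by
      intro i j hj
      rw [← Polynomial.coeff_C_mul]
      refine (mk_eq _ _).mp ?_ j hj
      have := congrFun hs i
      rw [telescopeMap_apply, ← hg, ← hg] at this
      exact sub_eq_zero.mp this
    ext i
    rw [← hg]
    refine (mk_eq _ 0).mpr fun j hj ↦ ?_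
    have : (fun i ↦ (g i).coeff j) = 0 := by
      apply h.1
      ext i
      simp [← hgC i j hj]
    exact congrFun this i
  · intro m
    choose f hf using fun i ↦ Ideal.Quotient.mk_surjective (m i)
    choose c hc using fun j ↦ h.2 fun i ↦ (f i).coeff j
    refine ⟨fun i ↦ Ideal.Quotient.mk _ (∑ j ∈ Finset.range n, Polynomial.monomial j (c j i)), ?_⟩
    ext i
    rw [← hf]
    refine (mk_eq (_ - Polynomial.C t * _) _).mpr fun j hj ↦ ?_
    simpa [Polynomial.coeff_monomial, hj] using congrFun (hc j) i

lemma PowerSeries.telescopeMap_X_bijective (A : Type u) [CommRing A] :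
    Function.Bijective (telescopeMap (PowerSeries.X : PowerSeries A) (PowerSeries A)) := by
  constructor
  · rw [← LinearMap.ker_eq_bot, LinearMap.ker_eq_bot']
    intro s hs
    have hs' : ∀ i, s i = X * s (i + 1) := fun i ↦ sub_eq_zero.mp (congrFun hs i)
    suffices ∀ d i, coeff d (s i) = 0 by
      ext i d
      exact this d i
    intro d
    induction d with
    | zero =>
      intro i
      rw [hs']
      simp
    | succ d ih =>
      intro i
      rw [hs', coeff_succ_X_mul, ih]
  · intro m
    refine ⟨fun i ↦ mk fun d ↦ ∑ j ∈ Finset.range (d + 1), coeff (d - j) (m (i + j)), ?_⟩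
    ext i d
    cases d with
    | zero => simp
    | succ d =>
      rw [telescopeMap_apply, smul_eq_mul, map_sub, coeff_succ_X_mul, coeff_mk, coeff_mk,
        Finset.sum_range_succ']
      simp [add_assoc, add_comm 1]

lemma Polynomial.jacobson_bot (A : Type*) [CommRing A] [IsDomain A] :
    Ideal.jacobson (⊥ : Ideal (Polynomial A)) = ⊥ := by
  refine le_bot_iff.mp fun f hf ↦ ?_
  by_contra hf₀
  have h := natDegree_eq_zero_of_isUnit (Ideal.mem_jacobson_bot.mp hf X)
  rw [← C_1, natDegree_add_C, natDegree_mul_X hf₀] at h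
  exact Nat.succ_ne_zero _ h

/-!
STATEMENT 14: For a field `k`, the cosupport of `T = k[[t]][x]` is not a
Zariski-closed subset of `Spec T`: there is no ideal `J` of `T` such that the
cosupport of `T` equals the set of primes containing `J`.
-/
theorem cosupport_not_closed (k : Type) [Field k] :
    ¬ ∃ J : Ideal (Polynomial (PowerSeries k)),
        ringCosupport (Polynomial (PowerSeries k)) =
          { p : PrimeSpectrum (Polynomial (PowerSeries k)) | J ≤ p.asIdeal } := by
  rintro ⟨J, hJ⟩
  have hJ_bot : J = ⊥ := by
    refine le_bot_iff.mp (le_of_le_of_eq ?_ (Polynomial.jacobson_bot _))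
    refine le_sInf fun m hm ↦ ?_
    have := mem_ringCosupport_of_isMaximal ⟨m, hm.2.isPrime⟩ hm.2
    rwa [hJ] at this
  have hX : (Ideal.span {(Polynomial.X : Polynomial (PowerSeries k))}).IsPrime :=
    (Ideal.span_singleton_prime Polynomial.X_ne_zero).mpr Polynomial.prime_X
  let p : PrimeSpectrum (Polynomial (PowerSeries k)) := ⟨_, hX⟩
  obtain ⟨i, hi⟩ : p ∈ ringCosupport (Polynomial (PowerSeries k)) := by
    rw [hJ, hJ_bot]
    exact bot_le (α := Ideal _)
  refine not_subsingleton_iff_nontrivial.mpr hi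
    (subsingleton_Ext_of_telescopeMap_bijective (t := Polynomial.C PowerSeries.X) ?_ ?_ i)
  · have ht : Polynomial.C PowerSeries.X ∉ p.asIdeal := fun h ↦ by
      simpa [PowerSeries.X_ne_zero] using Polynomial.X_dvd_iff.mp (Ideal.mem_span_singleton.mp h)
    let t : p.asIdeal.primeCompl := ⟨Polynomial.C PowerSeries.X, ht⟩
    exact (Module.End.isUnit_iff _).mp
      (IsLocalizedModule.map_units (Algebra.linearMap _ (Localization.AtPrime p.asIdeal)) t)
  · refine AdicCompletion.telescopeMap_bijective fun n ↦
      telescopeMap_polynomial_bijective (PowerSeries.telescopeMap_X_bijective k) (n := n) ?_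
    rw [smul_eq_mul, Ideal.mul_top]
    exact Ideal.span_singleton_pow _ n
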